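/- arXiv:2601.08039 — 2 statements merged into one kernel-verified Lean document; each statement's English description precedes it below -/
import Mathlib

section
/- Let d ≥ 1, let v ~ Unif(S^{d−1}), and let T be a symmetric trilinear form on ℝ^d with coefficients T_{ijk} = T(e_i, e_j, e_k) in the standard basis. Then E[(T(v, v, v))²] = (6 · Σ_{i,j,k} T_{ijk}² + 9 · Σ_k (Σ_i T_{iik})²) / (d(d+2)(d+4)). -/
open MeasureTheory

/-- The uniform probability measure on the unit sphere `S^{d-1} ⊆ ℝ^d`, i.e. the normalized
`(d-1)`-dimensional Hausdorff measure restricted to the sphere. -/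
noncomputable def sphereUniform (d : ℕ) : Measure (EuclideanSpace ℝ (Fin d)) :=
  (μH[(d : ℝ) - 1] (Metric.sphere (0 : EuclideanSpace ℝ (Fin d)) 1))⁻¹ •
    (μH[(d : ℝ) - 1]).restrict (Metric.sphere (0 : EuclideanSpace ℝ (Fin d)) 1)

section

open Metric Module Topology

theorem hausdorffMeasure_sphere_lt_top {E : Type*} [NormedAddCommGroup E] [InnerProductSpace ℝ E]
    [MeasurableSpace E] [BorelSpace E] {n : ℕ} [hE : Fact (finrank ℝ E = n + 1)] :
    μH[(n : ℝ)] (sphere (0 : E) 1) < ⊤ := by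
  have : FiniteDimensional ℝ E := .of_fact_finrank_eq_succ n
  refine (isCompact_sphere (0 : E) 1).measure_lt_top_of_nhdsWithin fun x hx => ?_
  have hx1 : ‖x‖ = 1 := by simpa using hx
  have hv : ‖-x‖ = 1 := by simpa using hx1
  have hv0 : -x ≠ 0 := by
    intro h
    simp [h] at hv
  have hfin : finrank ℝ (ℝ ∙ (-x))ᗮ = n := Submodule.finrank_orthogonal_span_singleton hv0
  have hg : ContDiff ℝ 1 (fun w : (ℝ ∙ (-x))ᗮ => stereoInvFunAux (-x) (w : E)) :=
    contDiff_stereoInvFunAux.comp (ℝ ∙ (-x))ᗮ.subtypeL.contDiff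
  obtain ⟨K, t, ht, hK⟩ := hg.locallyLipschitz (stereoToFun (-x) x)
  have hopen : IsOpen {y : E | innerSL ℝ (-x) y ≠ 1} :=
    isOpen_ne_fun (innerSL ℝ (-x)).continuous continuous_const
  have hmem : {y : E | innerSL ℝ (-x) y ≠ 1} ∈ 𝓝 x := by
    refine hopen.mem_nhds ?_
    simp [hx1]
    norm_num
  have hcont : ContinuousAt (stereoToFun (-x)) x := continuousOn_stereoToFun.continuousAt hmem
  set s := t ∩ ball (stereoToFun (-x) x) 1
  have hs_nhds : s ∈ 𝓝 (stereoToFun (-x) x) := Filter.inter_mem ht (ball_mem_nhds _ one_pos)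
  refine ⟨(fun w : (ℝ ∙ (-x))ᗮ => stereoInvFunAux (-x) (w : E)) '' s, ?_, ?_⟩
  · refine Filter.mem_of_superset (Filter.inter_mem self_mem_nhdsWithin
      (mem_nhdsWithin_of_mem_nhds (Filter.inter_mem hmem (hcont hs_nhds)))) ?_
    rintro y ⟨hy, hy1, hy2⟩
    refine ⟨_, hy2, ?_⟩
    have hne : y ≠ -x := by
      rintro rfl
      apply hy1
      simp [hx1]
    exact congrArg Subtype.val (stereo_left_inv hv (x := ⟨y, hy⟩) hne)
  · refine ((hK.mono Set.inter_subset_left).hausdorffMeasure_image_le n.cast_nonneg).trans_lt ?_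
    refine ENNReal.mul_lt_top (by simp) ?_
    have : (μH[(n : ℝ)] : Measure (ℝ ∙ (-x))ᗮ).IsAddHaarMeasure := by
      rw [← hfin]; infer_instance
    exact (measure_mono Set.inter_subset_right).trans_lt measure_ball_lt_top

theorem hausdorffMeasure_sphere_pos {E : Type*} [NormedAddCommGroup E] [InnerProductSpace ℝ E]
    [MeasurableSpace E] [BorelSpace E] {n : ℕ} [hE : Fact (finrank ℝ E = n + 1)] :
    0 < μH[(n : ℝ)] (sphere (0 : E) 1) := by
  have : FiniteDimensional ℝ E := .of_fact_finrank_eq_succ n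
  have : Nontrivial E := nontrivial_of_finrank_pos (R := ℝ) (by rw [hE.out]; omega)
  obtain ⟨v, hv⟩ := exists_norm_eq E zero_le_one
  have hv0 : v ≠ 0 := by
    rintro rfl
    simp at hv
  have hfin : finrank ℝ (ℝ ∙ v)ᗮ = n := Submodule.finrank_orthogonal_span_singleton hv0
  have : (μH[(n : ℝ)] : Measure (ℝ ∙ v)ᗮ).IsAddHaarMeasure := by
    rw [← hfin]; infer_instance
  have hsub : ball (0 : (ℝ ∙ v)ᗮ) 1 ⊆ (ℝ ∙ v)ᗮ.orthogonalProjectionOnto '' sphere (0 : E) 1 := by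
    intro w hw
    have hw1 : ‖(w : E)‖ < 1 := by simpa using hw
    have hin : inner ℝ (w : E) v = 0 :=
      (Submodule.mem_orthogonal_singleton_iff_inner_left).1 w.2
    refine ⟨w + √(1 - ‖(w : E)‖ ^ 2) • v, ?_, ?_⟩
    · have h0 : 0 ≤ 1 - ‖(w : E)‖ ^ 2 := by nlinarith [norm_nonneg (w : E)]
      have : ‖(w : E) + √(1 - ‖(w : E)‖ ^ 2) • v‖ ^ 2 = 1 := by
        rw [norm_add_sq_real, inner_smul_right, hin, norm_smul, hv, mul_one, Real.norm_eq_abs,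
          sq_abs, Real.sq_sqrt h0]
        ring
      rw [mem_sphere_zero_iff_norm]
      exact (pow_eq_one_iff_of_nonneg (norm_nonneg _) two_ne_zero).1 this
    · have : (ℝ ∙ v)ᗮ.orthogonalProjectionOnto v = 0 := by
        rw [Submodule.orthogonalProjectionOnto_eq_zero_iff]
        exact Submodule.le_orthogonal_orthogonal _ (Submodule.mem_span_singleton_self v)
      simp [this]
  have hlip : LipschitzWith 1 (ℝ ∙ v)ᗮ.orthogonalProjectionOnto :=
    ContinuousLinearMap.lipschitzWith_of_opNorm_le (Submodule.orthogonalProjectionOnto_norm_le _)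
  have h1 : 0 < μH[(n : ℝ)] (ball (0 : (ℝ ∙ v)ᗮ) 1) := measure_ball_pos _ _ one_pos
  calc 0 < μH[(n : ℝ)] (ball (0 : (ℝ ∙ v)ᗮ) 1) := h1
    _ ≤ _ := measure_mono hsub
    _ ≤ _ := hlip.hausdorffMeasure_image_le n.cast_nonneg _
    _ = _ := by simp

theorem isProbabilityMeasure_sphereUniform {d : ℕ} (hd : 1 ≤ d) :
    IsProbabilityMeasure (sphereUniform d) := by
  obtain ⟨n, rfl⟩ := Nat.exists_eq_add_of_le' hd
  have : Fact (finrank ℝ (EuclideanSpace ℝ (Fin (n + 1))) = n + 1) := ⟨by simp⟩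
  have hn : ((n + 1 : ℕ) : ℝ) - 1 = n := by push_cast; ring
  constructor
  simp only [sphereUniform, hn, Measure.smul_apply, Measure.restrict_apply_univ, smul_eq_mul]
  exact ENNReal.inv_mul_cancel hausdorffMeasure_sphere_pos.ne' hausdorffMeasure_sphere_lt_top.ne

theorem ae_norm_eq_one_sphereUniform (d : ℕ) : ∀ᵐ x ∂sphereUniform d, ‖x‖ = 1 := by
  refine Measure.ae_smul_measure ?_ _
  filter_upwards [ae_restrict_mem isClosed_sphere.measurableSet] with x hx
  simpa using hx

theorem measurePreserving_sphereUniform {d : ℕ}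
    (e : EuclideanSpace ℝ (Fin d) ≃ₗᵢ[ℝ] EuclideanSpace ℝ (Fin d)) :
    MeasurePreserving e (sphereUniform d) (sphereUniform d) := by
  have h := (e.toIsometryEquiv.measurePreserving_hausdorffMeasure
    ((d : ℝ) - 1)).restrict_preimage (isClosed_sphere (x := 0) (ε := 1)).measurableSet
  have hpre : e.toIsometryEquiv ⁻¹' sphere 0 1 = sphere 0 1 := by
    ext x
    simp
  rw [hpre] at h
  exact h.smul_measure _

theorem integrable_sphereUniform {d : ℕ} (hd : 1 ≤ d) {f : EuclideanSpace ℝ (Fin d) → ℝ}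
    (hf : Continuous f) : Integrable f (sphereUniform d) := by
  have := isProbabilityMeasure_sphereUniform hd
  obtain ⟨C, hC⟩ := (isCompact_sphere (0 : EuclideanSpace ℝ (Fin d)) 1).exists_bound_of_continuousOn
    hf.continuousOn
  refine Integrable.of_bound hf.aestronglyMeasurable C ?_
  filter_upwards [ae_norm_eq_one_sphereUniform d] with x hx
  exact hC x (by simpa using hx)

theorem integral_sphereUniform_comp {d : ℕ}
    (e : EuclideanSpace ℝ (Fin d) ≃ₗᵢ[ℝ] EuclideanSpace ℝ (Fin d))
    (f : EuclideanSpace ℝ (Fin d) → ℝ) :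
    ∫ x, f (e x) ∂sphereUniform d = ∫ x, f x ∂sphereUniform d :=
  (measurePreserving_sphereUniform e).integral_comp e.toHomeomorph.measurableEmbedding f

/-- Infinitesimal rotation invariance of the uniform measure on the sphere. -/
theorem integral_sphereUniform_fderiv_rotation {d : ℕ} (hd : 1 ≤ d)
    {f : EuclideanSpace ℝ (Fin d) → ℝ} (hf : ContDiff ℝ 1 f) {a b : EuclideanSpace ℝ (Fin d)}
    (ha : ‖a‖ = 1) (hb : ‖b‖ = 1) (hab : inner ℝ a b = 0) :
    ∫ x, fderiv ℝ f x (inner ℝ a x • b - inner ℝ b x • a) ∂sphereUniform d = 0 := by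
  have := isProbabilityMeasure_sphereUniform hd
  set u : ℝ → EuclideanSpace ℝ (Fin d) := fun t => Real.cos t • a + Real.sin t • b with hu
  set u' : ℝ → EuclideanSpace ℝ (Fin d) := fun t => -Real.sin t • a + Real.cos t • b with hu'
  have hu_norm (t : ℝ) : ‖u t‖ = 1 := by
    have : ‖u t‖ ^ 2 = 1 := by
      rw [hu, norm_add_sq_real, norm_smul, norm_smul, inner_smul_left, inner_smul_right, hab,
        ha, hb]
      simp
    exact (pow_eq_one_iff_of_nonneg (norm_nonneg _) two_ne_zero).1 this
  have hu_deriv (t : ℝ) : HasDerivAt u (u' t) t :=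
    ((Real.hasDerivAt_cos t).smul_const a).add ((Real.hasDerivAt_sin t).smul_const b)
  have hu_cont : Continuous u := by fun_prop
  have hu'_cont : Continuous u' := by fun_prop
  set S : ℝ → EuclideanSpace ℝ (Fin d) → EuclideanSpace ℝ (Fin d) :=
    fun t x => (2 * inner ℝ (u t) x) • u t - x with hS
  set S' : ℝ → EuclideanSpace ℝ (Fin d) → EuclideanSpace ℝ (Fin d) :=
    fun t x => (2 * inner ℝ (u t) x) • u' t + (2 * inner ℝ (u' t) x) • u t with hS'
  have hS_eq (t : ℝ) (x) : S t x = (ℝ ∙ u t).reflection x := by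
    rw [Submodule.reflection_singleton_apply, hu_norm]
    simp [hS, two_smul, two_mul, add_smul]
  have hS_deriv (t : ℝ) (x) : HasDerivAt (fun t => S t x) (S' t x) t := by
    have h1 : HasDerivAt (fun t => inner ℝ (u t) x) (inner ℝ (u' t) x) t := by
      simpa using (hu_deriv t).inner ℝ (hasDerivAt_const t x)
    exact ((h1.const_mul 2).smul (hu_deriv t)).sub_const x
  set F' : ℝ → EuclideanSpace ℝ (Fin d) → ℝ := fun t x => fderiv ℝ f (S t x) (S' t x) with hF'
  have hf' : Continuous (fderiv ℝ f) := hf.continuous_fderiv one_ne_zero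
  have hF'_cont : Continuous (fun p : ℝ × EuclideanSpace ℝ (Fin d) => F' p.1 p.2) := by
    have h1 : Continuous (fun p : ℝ × EuclideanSpace ℝ (Fin d) => S p.1 p.2) := by fun_prop
    have h2 : Continuous (fun p : ℝ × EuclideanSpace ℝ (Fin d) => S' p.1 p.2) := by fun_prop
    exact (hf'.comp h1).clm_apply h2
  obtain ⟨C, hC⟩ := ((isCompact_Icc (a := (-1 : ℝ)) (b := 1)).prod
    (isCompact_sphere (0 : EuclideanSpace ℝ (Fin d)) 1)).exists_bound_of_continuousOn
      hF'_cont.continuousOn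
  have hderiv := (hasDerivAt_integral_of_dominated_loc_of_deriv_le (μ := sphereUniform d)
    (F := fun t x => f (S t x)) (F' := F') (bound := fun _ => C) (x₀ := 0)
    (Icc_mem_nhds (by norm_num : (-1 : ℝ) < 0) (by norm_num : (0 : ℝ) < 1))
    (.of_forall fun t => (hf.continuous.comp (by fun_prop)).aestronglyMeasurable)
    (integrable_sphereUniform hd (hf.continuous.comp (by fun_prop)))
    (hF'_cont.comp (by fun_prop : Continuous fun x => ((0 : ℝ), x))).aestronglyMeasurable
    (by
      filter_upwards [ae_norm_eq_one_sphereUniform d] with x hx t ht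
      exact hC (t, x) ⟨ht, by simpa using hx⟩)
    (integrable_const C)
    (.of_forall fun x t _ =>
      ((hf.differentiable one_ne_zero _).hasFDerivAt).comp_hasDerivAt t (hS_deriv t x))).2
  have hconst : (fun t => ∫ x, f (S t x) ∂sphereUniform d) =
      fun _ => ∫ x, f x ∂sphereUniform d := by
    funext t
    simp only [hS_eq]
    exact integral_sphereUniform_comp _ f
  rw [hconst] at hderiv
  have h0 : ∫ x, F' 0 x ∂sphereUniform d = 0 := hderiv.unique (hasDerivAt_const _ _)
  have hF'0 (x) : F' 0 x = 2 * (fun y => fderiv ℝ f y (inner ℝ a y • b - inner ℝ b y • a))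
      ((ℝ ∙ u 0).reflection x) := by
    have hu0 : u 0 = a := by simp [hu]
    have hu'0 : u' 0 = b := by simp [hu']
    have hba : inner ℝ b a = 0 := by rw [real_inner_comm, hab]
    have e1 : S' 0 x = (2 : ℝ) • (inner ℝ a (S 0 x) • b - inner ℝ b (S 0 x) • a) := by
      simp only [hS', hS, hu0, hu'0, inner_sub_right, inner_smul_right, hba,
        real_inner_self_eq_norm_sq, ha]
      module
    simp only [hF', ← hS_eq, e1, map_smul, smul_eq_mul]
  simp only [hF'0] at h0
  rw [integral_const_mul] at h0
  have hinv := integral_sphereUniform_comp (ℝ ∙ u 0).reflection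
    fun y => fderiv ℝ f y (inner ℝ a y • b - inner ℝ b y • a)
  linarith

theorem fderiv_coord_mul {d : ℕ} {h : EuclideanSpace ℝ (Fin d) → ℝ}
    {x : EuclideanSpace ℝ (Fin d)} (hh : DifferentiableAt ℝ h x) (j : Fin d)
    (w : EuclideanSpace ℝ (Fin d)) :
    fderiv ℝ (fun x => x j * h x) x w = x j * fderiv ℝ h x w + w j * h x := by
  have hj : HasFDerivAt (fun x : EuclideanSpace ℝ (Fin d) => x j)
    (EuclideanSpace.proj (𝕜 := ℝ) j) x := (EuclideanSpace.proj (𝕜 := ℝ) j).hasFDerivAt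
  rw [(hj.fun_mul hh.hasFDerivAt).fderiv]
  simp [mul_comm]

/-- Integration by parts on the sphere, for functions satisfying the Euler identity of degree
`k`. -/
theorem integral_sphereUniform_coord_mul {d : ℕ} (hd : 1 ≤ d)
    {h : EuclideanSpace ℝ (Fin d) → ℝ} (hh : ContDiff ℝ 1 h) {k : ℝ}
    (hk : ∀ x, fderiv ℝ h x x = k * h x) (i : Fin d) :
    (d - 1 + k) * ∫ x, x i * h x ∂sphereUniform d =
      ∫ x, fderiv ℝ h x (EuclideanSpace.single i 1) ∂sphereUniform d := by
  have hh' : Continuous (fderiv ℝ h) := hh.continuous_fderiv one_ne_zero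
  have hhc := hh.continuous
  have hcoord (j : Fin d) : ContDiff ℝ 1 (fun x : EuclideanSpace ℝ (Fin d) => x j) :=
    (EuclideanSpace.proj (𝕜 := ℝ) j).contDiff
  have hrot (j : Fin d) : ∫ x, fderiv ℝ (fun x => x j * h x) x
      (x i • EuclideanSpace.single j 1 - x j • EuclideanSpace.single i 1) ∂sphereUniform d = 0 := by
    rcases eq_or_ne i j with rfl | hij
    · simp
    · simpa [EuclideanSpace.inner_single_left] using integral_sphereUniform_fderiv_rotation hd
        ((hcoord j).mul hh) (a := EuclideanSpace.single i 1) (b := EuclideanSpace.single j 1)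
        (by simp) (by simp) (by simp [EuclideanSpace.inner_single_left, hij])
  have hsum (x : EuclideanSpace ℝ (Fin d)) (hx : ‖x‖ = 1) :
      ∑ j, fderiv ℝ (fun x => x j * h x) x
        (x i • EuclideanSpace.single j 1 - x j • EuclideanSpace.single i 1) =
      (d - 1 + k) * (x i * h x) - fderiv ℝ h x (EuclideanSpace.single i 1) := by
    have hx2 : ∑ j, x j ^ 2 = 1 := by
      rw [← EuclideanSpace.real_norm_sq_eq, hx, one_pow]
    have hxs : ∑ j, x j * fderiv ℝ h x (EuclideanSpace.single j 1) = k * h x := by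
      have hx3 := congrArg (fderiv ℝ h x) ((EuclideanSpace.basisFun (Fin d) ℝ).sum_repr x)
      rw [hk x, map_sum] at hx3
      simpa using hx3
    have hterm (j : Fin d) : fderiv ℝ (fun x => x j * h x) x
        (x i • EuclideanSpace.single j 1 - x j • EuclideanSpace.single i 1) =
        x i * (x j * fderiv ℝ h x (EuclideanSpace.single j 1)) -
          x j ^ 2 * fderiv ℝ h x (EuclideanSpace.single i 1) + x i * h x -
          (if j = i then x i * h x else 0) := by
      rw [fderiv_coord_mul (hh.differentiable one_ne_zero x), map_sub, map_smul, map_smul]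
      rcases eq_or_ne j i with rfl | hij
      · simp
        ring
      · simp [hij]
        ring
    simp only [hterm, Finset.sum_sub_distrib, Finset.sum_add_distrib, ← Finset.mul_sum,
      ← Finset.sum_mul, hx2, hxs]
    simp
    ring
  have hzero : ∫ x, ((d - 1 + k) * (x i * h x) - fderiv ℝ h x (EuclideanSpace.single i 1))
      ∂sphereUniform d = 0 := by
    rw [← integral_congr_ae ((ae_norm_eq_one_sphereUniform d).mono hsum),
      integral_finsetSum _ fun j _ => integrable_sphereUniform hd ?_]
    · exact Finset.sum_eq_zero fun j _ => hrot j
    · exact (((hcoord j).mul hh).continuous_fderiv one_ne_zero).clm_apply (by fun_prop)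
  rw [integral_sub, integral_const_mul] at hzero
  · linarith
  · exact integrable_sphereUniform hd (by fun_prop)
  · exact integrable_sphereUniform hd (by fun_prop)

/-- The monomial `x ↦ ∏ x i` over the indices `i` in the list `L`, with multiplicity. -/
def coordMonomial {d : ℕ} (L : List (Fin d)) (x : EuclideanSpace ℝ (Fin d)) : ℝ :=
  (L.map fun i => x i).prod

theorem coordMonomial_cons {d : ℕ} (j : Fin d) (L : List (Fin d)) :
    coordMonomial (j :: L) = fun x => x j * coordMonomial L x := by
  funext x
  simp [coordMonomial]

theorem contDiff_coordMonomial {d : ℕ} (L : List (Fin d)) : ContDiff ℝ 1 (coordMonomial L) := by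
  induction L with
  | nil => exact contDiff_const
  | cons j L ih =>
    rw [coordMonomial_cons]
    exact (EuclideanSpace.proj (𝕜 := ℝ) j).contDiff.mul ih

theorem fderiv_coordMonomial_nil {d : ℕ} (x w : EuclideanSpace ℝ (Fin d)) :
    fderiv ℝ (coordMonomial []) x w = 0 := by
  have : coordMonomial ([] : List (Fin d)) = fun _ => 1 := by
    funext x
    simp [coordMonomial]
  simp [this]

theorem fderiv_coordMonomial_cons {d : ℕ} (j : Fin d) (L : List (Fin d))
    (x w : EuclideanSpace ℝ (Fin d)) :
    fderiv ℝ (coordMonomial (j :: L)) x w =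
      x j * fderiv ℝ (coordMonomial L) x w + w j * coordMonomial L x := by
  rw [coordMonomial_cons,
    fderiv_coord_mul ((contDiff_coordMonomial L).differentiable one_ne_zero x)]

theorem fderiv_coordMonomial_self {d : ℕ} (L : List (Fin d)) (x : EuclideanSpace ℝ (Fin d)) :
    fderiv ℝ (coordMonomial L) x x = L.length * coordMonomial L x := by
  induction L with
  | nil => simp [fderiv_coordMonomial_nil]
  | cons j L ih =>
    rw [fderiv_coordMonomial_cons, ih, coordMonomial_cons]
    push_cast [List.length_cons]
    ring

theorem integrable_coordMonomial {d : ℕ} (hd : 1 ≤ d) (L : List (Fin d)) :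
    Integrable (coordMonomial L) (sphereUniform d) :=
  integrable_sphereUniform hd (contDiff_coordMonomial L).continuous

theorem integral_coordMonomial_cons {d : ℕ} (hd : 1 ≤ d) (i : Fin d) (L : List (Fin d)) :
    (d - 1 + L.length) * ∫ x, coordMonomial (i :: L) x ∂sphereUniform d =
      ∫ x, fderiv ℝ (coordMonomial L) x (EuclideanSpace.single i 1) ∂sphereUniform d := by
  rw [coordMonomial_cons]
  exact integral_sphereUniform_coord_mul hd (contDiff_coordMonomial L)
    (fderiv_coordMonomial_self L) i

theorem integral_coordMonomial_two {d : ℕ} (hd : 1 ≤ d) (i j : Fin d) :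
    d * ∫ x, coordMonomial [i, j] x ∂sphereUniform d = if i = j then 1 else 0 := by
  have := isProbabilityMeasure_sphereUniform hd
  have h := integral_coordMonomial_cons hd i [j]
  simp only [fderiv_coordMonomial_cons, fderiv_coordMonomial_nil, PiLp.single_apply,
    coordMonomial] at h
  simpa [coordMonomial, eq_comm] using h

theorem integral_coordMonomial_four {d : ℕ} (hd : 1 ≤ d) (i j k l : Fin d) :
    (d + 2) * ∫ x, coordMonomial [i, j, k, l] x ∂sphereUniform d =
      (if i = j then 1 else 0) * ∫ x, coordMonomial [k, l] x ∂sphereUniform d +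
      (if i = k then 1 else 0) * ∫ x, coordMonomial [j, l] x ∂sphereUniform d +
      (if i = l then 1 else 0) * ∫ x, coordMonomial [j, k] x ∂sphereUniform d := by
  have h := integral_coordMonomial_cons hd i [j, k, l]
  have hI (L : List (Fin d)) (c : ℝ) :
      Integrable (fun x => c * coordMonomial L x) (sphereUniform d) :=
    (integrable_coordMonomial hd L).const_mul c
  simp only [← integral_const_mul]
  rw [← integral_add (hI _ _) (hI _ _), ← integral_add ((hI _ _).fun_add (hI _ _)) (hI _ _),
    integral_const_mul]
  convert h using 1
  · push_cast [List.length_cons, List.length_nil]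
    ring
  · congr 1 with x
    simp only [fderiv_coordMonomial_cons, fderiv_coordMonomial_nil, PiLp.single_apply,
      coordMonomial, List.map_cons, List.map_nil, List.prod_cons, List.prod_nil, eq_comm (a := i)]
    ring

theorem integral_coordMonomial_six {d : ℕ} (hd : 1 ≤ d) (i j k l m n : Fin d) :
    (d + 4) * ∫ x, coordMonomial [i, j, k, l, m, n] x ∂sphereUniform d =
      (if i = j then 1 else 0) * ∫ x, coordMonomial [k, l, m, n] x ∂sphereUniform d +
      (if i = k then 1 else 0) * ∫ x, coordMonomial [j, l, m, n] x ∂sphereUniform d +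
      (if i = l then 1 else 0) * ∫ x, coordMonomial [j, k, m, n] x ∂sphereUniform d +
      (if i = m then 1 else 0) * ∫ x, coordMonomial [j, k, l, n] x ∂sphereUniform d +
      (if i = n then 1 else 0) * ∫ x, coordMonomial [j, k, l, m] x ∂sphereUniform d := by
  have h := integral_coordMonomial_cons hd i [j, k, l, m, n]
  have hI (L : List (Fin d)) (c : ℝ) :
      Integrable (fun x => c * coordMonomial L x) (sphereUniform d) :=
    (integrable_coordMonomial hd L).const_mul c
  simp only [← integral_const_mul]
  rw [← integral_add (hI _ _) (hI _ _), ← integral_add ((hI _ _).fun_add (hI _ _)) (hI _ _),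
    ← integral_add (((hI _ _).fun_add (hI _ _)).fun_add (hI _ _)) (hI _ _),
    ← integral_add ((((hI _ _).fun_add (hI _ _)).fun_add (hI _ _)).fun_add (hI _ _)) (hI _ _),
    integral_const_mul]
  convert h using 1
  · push_cast [List.length_cons, List.length_nil]
    ring
  · congr 1 with x
    simp only [fderiv_coordMonomial_cons, fderiv_coordMonomial_nil, PiLp.single_apply,
      coordMonomial, List.map_cons, List.map_nil, List.prod_cons, List.prod_nil, eq_comm (a := i)]
    ring

/-- The sixth moments of the uniform measure on the sphere, as a sum over the fifteen pairings. -/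
theorem integral_coordMonomial_six_eq_sum_pairings {d : ℕ} (hd : 1 ≤ d)
    (i j k l m n : Fin d) {δ : Fin d → Fin d → ℝ} (hδ : δ = fun a b => if a = b then 1 else 0) :
    d * (d + 2) * (d + 4) * ∫ x, coordMonomial [i, j, k, l, m, n] x ∂sphereUniform d =
      δ i j * (δ k l * δ m n + δ k m * δ l n + δ k n * δ l m) +
      δ i k * (δ j l * δ m n + δ j m * δ l n + δ j n * δ l m) +
      δ i l * (δ j k * δ m n + δ j m * δ k n + δ j n * δ k m) +
      δ i m * (δ j k * δ l n + δ j l * δ k n + δ j n * δ k l) +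
      δ i n * (δ j k * δ l m + δ j l * δ k m + δ j m * δ k l) := by
  have h4 (i j k l : Fin d) :
      d * (d + 2) * ∫ x, coordMonomial [i, j, k, l] x ∂sphereUniform d =
        δ i j * δ k l + δ i k * δ j l + δ i l * δ j k := by
    rw [mul_assoc, integral_coordMonomial_four hd]
    simp only [hδ, ← integral_coordMonomial_two hd k l, ← integral_coordMonomial_two hd j l,
      ← integral_coordMonomial_two hd j k]
    ring
  rw [mul_assoc, integral_coordMonomial_six hd, ← h4, ← h4, ← h4, ← h4, ← h4]
  simp only [hδ]
  ring

theorem sum_sum_mul_pairings {d : ℕ} {T : Fin d → Fin d → Fin d → ℝ}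
    (hsymm : ∀ i j k : Fin d, T i j k = T j i k ∧ T i j k = T i k j)
    {δ : Fin d → Fin d → ℝ} (hδ : δ = fun a b => if a = b then 1 else 0) :
    ∑ i, ∑ j, ∑ k, ∑ l, ∑ m, ∑ n, T i j k * T l m n *
      (δ i j * (δ k l * δ m n + δ k m * δ l n + δ k n * δ l m) +
      δ i k * (δ j l * δ m n + δ j m * δ l n + δ j n * δ l m) +
      δ i l * (δ j k * δ m n + δ j m * δ k n + δ j n * δ k m) +
      δ i m * (δ j k * δ l n + δ j l * δ k n + δ j n * δ k l) +
      δ i n * (δ j k * δ l m + δ j l * δ k m + δ j m * δ k l)) =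
    6 * ∑ i, ∑ j, ∑ k, T i j k ^ 2 + 9 * ∑ k, (∑ i, T i i k) ^ 2 := by
  have h1 (i j k) : T i j k = T j i k := (hsymm i j k).1
  have h2 (i j k) : T i j k = T i k j := (hsymm i j k).2
  subst hδ
  simp only [mul_add, Finset.sum_add_distrib, mul_ite, mul_one, mul_zero, Finset.sum_ite_eq,
    Finset.mem_univ, if_true, Finset.sum_ite_irrel, Finset.sum_const_zero]
  obtain ⟨U, hdiag⟩ : ∃ U : Fin d → Fin d → ℝ, ∀ i k, T i i k = U i k := ⟨_, fun _ _ => rfl⟩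
  have hswap : ∀ i j, T i j i = U i j := fun i j => by rw [← hdiag, h2]
  have hrot : ∀ i j, T i j j = U j i := fun i j => by rw [← hdiag, h1, h2]
  have hsq : ∀ i j k, T i j k * T i j k = T i j k ^ 2 ∧ T i j k * T i k j = T i j k ^ 2 ∧
      T i j k * T j i k = T i j k ^ 2 ∧ T i j k * T j k i = T i j k ^ 2 ∧
      T i j k * T k i j = T i j k ^ 2 ∧ T i j k * T k j i = T i j k ^ 2 := by
    intro i j k
    have e1 : T i k j = T i j k := h2 i k j
    have e2 : T j i k = T i j k := h1 j i k
    have e3 : T j k i = T i j k := (h2 j k i).trans e2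
    have e4 : T k i j = T i j k := (h1 k i j).trans e1
    have e5 : T k j i = T i j k := (h2 k j i).trans e4
    simp only [e1, e2, e3, e4, e5, sq, and_self]
  have htrace : ∑ i, ∑ k, ∑ j, U i k * U j k = ∑ k, (∑ i, U i k) ^ 2 := by
    rw [Finset.sum_comm]
    simp only [sq, Finset.sum_mul_sum]
  have htrace' : ∑ k, ∑ i, ∑ j, U i k * U j k = ∑ k, (∑ i, U i k) ^ 2 := by
    simp only [sq, Finset.sum_mul_sum]
  simp only [hsq, hdiag, hswap, hrot, htrace, htrace']
  ring

end

/-- For `v` uniform on `S^{d-1}` and a symmetric trilinear form with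
coefficients `T i j k` in the standard basis,
`E[(T(v,v,v))²] = (6 Σ_{ijk} T_{ijk}² + 9 Σ_k (Σ_i T_{iik})²) / (d(d+2)(d+4))`. -/
theorem sphere_trilinear_square_moment (d : ℕ) (hd : 1 ≤ d)
    (T : Fin d → Fin d → Fin d → ℝ)
    (hsymm : ∀ i j k : Fin d, T i j k = T j i k ∧ T i j k = T i k j) :
    ∫ v : EuclideanSpace ℝ (Fin d),
        (∑ i : Fin d, ∑ j : Fin d, ∑ k : Fin d, T i j k * v i * v j * v k) ^ 2
        ∂(sphereUniform d) =
      (6 * ∑ i : Fin d, ∑ j : Fin d, ∑ k : Fin d, (T i j k) ^ 2 +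
          9 * ∑ k : Fin d, (∑ i : Fin d, T i i k) ^ 2) /
        ((d : ℝ) * (d + 2) * (d + 4)) := by
  have hd0 : (0 : ℝ) < d := by exact_mod_cast hd
  have hexpand (v : EuclideanSpace ℝ (Fin d)) :
      (∑ i, ∑ j, ∑ k, T i j k * v i * v j * v k) ^ 2 =
        ∑ i, ∑ j, ∑ k, ∑ l, ∑ m, ∑ n,
          T i j k * T l m n * coordMonomial [i, j, k, l, m, n] v := by
    simp only [sq, Finset.sum_mul]
    simp only [Finset.mul_sum]
    refine Finset.sum_congr rfl fun i _ => Finset.sum_congr rfl fun j _ =>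
      Finset.sum_congr rfl fun k _ => Finset.sum_congr rfl fun l _ =>
      Finset.sum_congr rfl fun m _ => Finset.sum_congr rfl fun n _ => ?_
    simp only [coordMonomial, List.map_cons, List.map_nil, List.prod_cons, List.prod_nil]
    ring
  have hI (L : List (Fin d)) (c : ℝ) :
      Integrable (fun x => c * coordMonomial L x) (sphereUniform d) :=
    (integrable_coordMonomial hd L).const_mul c
  rw [eq_div_iff (by positivity), mul_comm, ← sum_sum_mul_pairings hsymm rfl]
  simp only [hexpand]
  simp (discharger := fun_prop (disch := assumption)) only
    [integral_finsetSum, integral_const_mul, Finset.mul_sum]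
  refine Finset.sum_congr rfl fun i _ => Finset.sum_congr rfl fun j _ =>
    Finset.sum_congr rfl fun k _ => Finset.sum_congr rfl fun l _ =>
    Finset.sum_congr rfl fun m _ => Finset.sum_congr rfl fun n _ => ?_
  rw [← integral_coordMonomial_six_eq_sum_pairings hd i j k l m n rfl]
  ring
end

section
/- Let A ∈ ℝ^{d×d} be symmetric positive definite and let L ∈ ℝ^{d×d} be an invertible matrix with Lᵀ A L = I_d. Let C := {v ∈ ℝ^d : vᵀ A v = 1}, and let σ_{S^{d−1}} and σ_C denote the (d−1)-dimensional Hausdorff measures on S^{d−1} and on C respectively. Define J(s) := |det L| · ‖(Lᵀ)^{-1} s‖₂ for s ∈ S^{d−1}. Then the pushforward measure σ_{S^{d−1}} ∘ L^{-1} on C is absolutely continuous with respect to σ_C with Radon–Nikodym density v ↦ 1/J(L^{-1} v); that is, for every Borel set E ⊆ C, σ_{S^{d−1}}(L^{-1}(E)) = ∫_E 1/J(L^{-1} v) dσ_C(v). -/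
open Matrix MeasureTheory

/-- Reinterpret a plain vector `Fin d → ℝ` as a point of Euclidean space. -/
noncomputable def toE {d : ℕ} (x : Fin d → ℝ) : EuclideanSpace ℝ (Fin d) :=
  (EuclideanSpace.equiv (Fin d) ℝ).symm x

/-- The `(d−1)`-dimensional Jacobian `J(s) = |det L| · ‖(Lᵀ)⁻¹ s‖₂` of the linear map `L`
restricted to the unit sphere. -/
noncomputable def sphereJacobian {d : ℕ} (L : Matrix (Fin d) (Fin d) ℝ)
    (s : EuclideanSpace ℝ (Fin d)) : ℝ :=
  |L.det| * ‖toE ((Lᵀ)⁻¹.mulVec fun i => s i)‖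

open Module in
/-- The hyperplane orthogonal to a unit vector `n` is parametrized by a linear isometry `i` from
Euclidean space, and `L` scales its volume by `|det L| * ‖(L⁻¹)† n‖`. -/
theorem LinearEquiv.exists_linearIsometry_normDet_comp {V : Type*} [NormedAddCommGroup V]
    [InnerProductSpace ℝ V] [FiniteDimensional ℝ V] {k : ℕ} (hk : finrank ℝ V = k + 1)
    (L : V ≃ₗ[ℝ] V) {n : V} (hn : ‖n‖ = 1) :
    ∃ i : EuclideanSpace ℝ (Fin k) →ₗᵢ[ℝ] V,
      (∀ x : V, ∃ u, x - inner ℝ n x • n = i u) ∧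
      ((L : V →ₗ[ℝ] V) ∘ₗ i.toLinearMap).normDet =
        |LinearMap.det (L : V →ₗ[ℝ] V)| * ‖LinearMap.adjoint (L.symm : V →ₗ[ℝ] V) n‖ := by
  obtain ⟨b, hb⟩ := Orthonormal.exists_orthonormalBasis_extension_of_card_eq (𝕜 := ℝ) (E := V)
    (ι := Fin (k + 1)) (by simp [hk]) (v := fun _ => n) (s := {0})
    ⟨fun _ => hn, fun a c hac => (hac (Subsingleton.elim a c)).elim⟩
  have hb0 : b 0 = n := hb 0 rfl
  have hsucc : Orthonormal ℝ (fun j : Fin k => b j.succ) :=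
    b.orthonormal.comp _ (Fin.succ_injective k)
  let e := EuclideanSpace.basisFun (Fin k) ℝ
  let i : EuclideanSpace ℝ (Fin k) →ₗᵢ[ℝ] V :=
    (e.toBasis.constr ℝ fun j => b j.succ).isometryOfOrthonormal (v := e.toBasis)
      (by simp)
      (by simpa [Function.comp_def, Basis.constr_basis] using hsucc)
  have hi (j) : i (e j) = b j.succ := by
    have := e.toBasis.constr_basis ℝ (fun j => b j.succ) j
    rwa [OrthonormalBasis.coe_toBasis] at this
  refine ⟨i, fun x => ⟨∑ j, inner ℝ (b j.succ) x • e j, ?_⟩, ?_⟩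
  · simp only [map_sum, i.map_smul, hi]
    rw [sub_eq_iff_eq_add', ← hb0, ← Fin.sum_univ_succ (fun j => inner ℝ (b j) x • b j),
      b.sum_repr' x]
  · set w := LinearMap.adjoint (L.symm : V →ₗ[ℝ] V)
    set G : Matrix (Fin (k + 1)) (Fin (k + 1)) ℝ := gram ℝ fun a => L (b a)
    set H : Matrix (Fin (k + 1)) (Fin (k + 1)) ℝ := gram ℝ fun a => w (b a)
    have hGH : G * H = 1 := by
      ext a c
      simp only [Matrix.mul_apply, G, H, gram_apply]
      have h1 (j) : inner ℝ (L (b a)) (L (b j)) =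
          inner ℝ (LinearMap.adjoint (L : V →ₗ[ℝ] V) (L (b a))) (b j) := by
        rw [LinearMap.adjoint_inner_left]; rfl
      have h2 (j) : inner ℝ (w (b j)) (w (b c)) = inner ℝ (b j) (L.symm (w (b c))) := by
        rw [LinearMap.adjoint_inner_left]; rfl
      simp only [h1, h2]
      rw [b.sum_inner_mul_inner, LinearMap.adjoint_inner_left]
      simp only [LinearEquiv.coe_coe, LinearEquiv.apply_symm_apply]
      rw [LinearMap.adjoint_inner_right]
      simp [Matrix.one_apply, b.inner_eq_ite]
    have hinv : G⁻¹ = H := Matrix.inv_eq_right_inv hGH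
    have hdet : G.det = LinearMap.det (L : V →ₗ[ℝ] V) ^ 2 := by
      have := (L : V →ₗ[ℝ] V).normDet_sq_eq_det_gram b
      rw [LinearMap.normDet_eq_abs_det] at this
      simpa using this.symm
    have hdet0 : IsUnit G.det := (Matrix.isUnit_iff_isUnit_det _).1 (IsUnit.of_mul_eq_one _ hGH)
    have hadj : G.adjugate 0 0 = G.det * H 0 0 := by
      rw [← hinv, Matrix.inv_def]
      simp [Ring.inverse_eq_inv', mul_inv_cancel_left₀ hdet0.ne_zero]
    have hN := ((L : V →ₗ[ℝ] V) ∘ₗ i.toLinearMap).normDet_sq_eq_det_gram e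
    have hsub : gram ℝ (fun j => ((L : V →ₗ[ℝ] V) ∘ₗ i.toLinearMap) (e j)) =
        G.submatrix (Fin.succAbove 0) (Fin.succAbove 0) := by
      ext a c
      simp [G, gram_apply, hi]
    rw [hsub] at hN
    rw [adjugate_fin_succ_eq_det_submatrix] at hadj
    have hH : H 0 0 = ‖w n‖ ^ 2 := by simp [H, gram_apply, hb0]
    rw [← sq_eq_sq₀ (LinearMap.normDet_nonneg _) (by positivity), mul_pow, sq_abs, ← hH, ← hdet,
      ← hadj]
    simpa using hN

/-- If distances of images under `f` are at most `K` times those under `g`, then the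
`r`-dimensional Hausdorff measures of the images compare with constant `K ^ r`. -/
theorem MeasureTheory.hausdorffMeasure_image_le_of_dist_le {X Y Z : Type*}
    [MetricSpace Y] [MeasurableSpace Y] [BorelSpace Y]
    [MetricSpace Z] [MeasurableSpace Z] [BorelSpace Z]
    {f : X → Y} {g : X → Z} {B : Set X} {K : NNReal} {r : ℝ} (hr : 0 ≤ r)
    (h : ∀ x ∈ B, ∀ y ∈ B, dist (f x) (f y) ≤ K * dist (g x) (g y)) :
    μH[r] (f '' B) ≤ (K : ENNReal) ^ r * μH[r] (g '' B) := by
  rcases B.eq_empty_or_nonempty with rfl | ⟨x0, -⟩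
  · simp
  have : Nonempty X := ⟨x0⟩
  have hinv : ∀ x ∈ B, Function.invFunOn g B (g x) ∈ B ∧ g (Function.invFunOn g B (g x)) = g x :=
    fun x hx => ⟨Function.invFunOn_mem ⟨x, hx, rfl⟩, Function.invFunOn_eq ⟨x, hx, rfl⟩⟩
  have hfg : ∀ x ∈ B, f (Function.invFunOn g B (g x)) = f x := fun x hx => by
    have := h _ (hinv x hx).1 x hx
    rw [(hinv x hx).2, dist_self, mul_zero] at this
    exact dist_le_zero.1 this
  have hlip : LipschitzOnWith K (f ∘ Function.invFunOn g B) (g '' B) := by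
    refine LipschitzOnWith.of_dist_le_mul ?_
    rintro _ ⟨x, hx, rfl⟩ _ ⟨y, hy, rfl⟩
    simpa [hfg x hx, hfg y hy] using h x hx y hy
  have := hlip.hausdorffMeasure_image_le hr
  rwa [Set.image_image, Set.image_congr (fun x hx => by exact hfg x hx)] at this

/-- An inequality between two measures that holds locally on `S` holds on every measurable subset
of `S`. -/
theorem MeasureTheory.Measure.le_mul_of_forall_ball {X : Type*} [PseudoMetricSpace X]
    [SecondCountableTopology X] [MeasurableSpace X] [BorelSpace X] {μ ν : Measure X}
    {S : Set X} {c : ENNReal}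
    (h : ∀ x ∈ S, ∃ δ > 0, ∀ B ⊆ S ∩ Metric.ball x δ, MeasurableSet B → μ B ≤ c * ν B)
    {B : Set X} (hBS : B ⊆ S) (hB : MeasurableSet B) : μ B ≤ c * ν B := by
  choose! δ hδ h using h
  obtain ⟨t, htS, htc, ht⟩ := TopologicalSpace.countable_cover_nhdsWithin
    (f := fun x => Metric.ball x (δ x)) (s := S)
    fun x hx => mem_nhdsWithin_of_mem_nhds (Metric.ball_mem_nhds x (hδ x hx))
  rcases t.eq_empty_or_nonempty with rfl | hne
  · have : B = ∅ := by
      rw [Set.eq_empty_iff_forall_notMem]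
      intro x hx
      simpa using ht (hBS hx)
    simp [this]
  obtain ⟨s, rfl⟩ := htc.exists_eq_range hne
  set W : ℕ → Set X := fun j => B ∩ disjointed (fun j => Metric.ball (s j) (δ (s j))) j
  have hWm (j) : MeasurableSet (W j) :=
    hB.inter (MeasurableSet.disjointed (fun _ => measurableSet_ball) j)
  have hWd : Pairwise (Function.onFun Disjoint W) := fun a c hac =>
    (disjoint_disjointed _ hac).mono Set.inter_subset_right Set.inter_subset_right
  have hBW : B = ⋃ j, W j := by
    rw [← Set.inter_iUnion, iUnion_disjointed]
    refine (Set.inter_eq_left.2 ?_).symm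
    simpa using hBS.trans ht
  rw [hBW, measure_iUnion hWd hWm, measure_iUnion hWd hWm, ← ENNReal.tsum_mul_left]
  exact ENNReal.tsum_le_tsum fun j => h (s j) (htS ⟨j, rfl⟩) _
    (fun x hx => ⟨hBS hx.1, disjointed_le (fun j => Metric.ball (s j) (δ (s j))) j hx.2⟩) (hWm j)


open Module in
/-- Near a point `n` of the unit sphere, `L` scales the surface measure of the sphere by
`|det L| * ‖(L⁻¹)† n‖`, up to powers of any constant `K > 1`. The proof compares the sphere with its
tangent hyperplane at `n`. -/
theorem LinearEquiv.exists_ball_hausdorffMeasure_image_sphere_le {V : Type*}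
    [NormedAddCommGroup V] [InnerProductSpace ℝ V] [FiniteDimensional ℝ V] [MeasurableSpace V]
    [BorelSpace V] {k : ℕ} (hk : finrank ℝ V = k + 1) (L : V ≃ₗ[ℝ] V) {n : V} (hn : ‖n‖ = 1)
    {K : NNReal} (hK : 1 < K) :
    ∃ δ > 0, ∀ B ⊆ Metric.sphere (0 : V) 1 ∩ Metric.ball n δ,
      μH[k] (L '' B) ≤ (K : ENNReal) ^ k * (ENNReal.ofReal (|LinearMap.det (L : V →ₗ[ℝ] V)| *
          ‖LinearMap.adjoint (L.symm : V →ₗ[ℝ] V) n‖) * μH[k] B) ∧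
      ENNReal.ofReal (|LinearMap.det (L : V →ₗ[ℝ] V)| *
          ‖LinearMap.adjoint (L.symm : V →ₗ[ℝ] V) n‖) * μH[k] B ≤
        (K : ENNReal) ^ k * ((K : ENNReal) ^ k * μH[k] (L '' B)) := by
  obtain ⟨i, hi, hdet⟩ := L.exists_linearIsometry_normDet_comp hk hn
  rw [← hdet]
  choose p hp using hi
  set C := ‖(L.toContinuousLinearEquiv : V →L[ℝ] V)‖
  set c := ‖(L.symm.toContinuousLinearEquiv : V →L[ℝ] V)‖
  have hC (z : V) : ‖L z‖ ≤ C * ‖z‖ := (L.toContinuousLinearEquiv : V →L[ℝ] V).le_opNorm z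
  have hc (z : V) : ‖z‖ ≤ c * ‖L z‖ := by
    simpa using (L.symm.toContinuousLinearEquiv : V →L[ℝ] V).le_opNorm (L z)
  have hC0 : 0 ≤ C := norm_nonneg _
  have hc0 : 0 ≤ c := norm_nonneg _
  have hκ0 : 0 ≤ C * c := by positivity
  have hK1 : (1 : ℝ) < K := by exact_mod_cast hK
  have hKpos : (0 : ℝ) < K := by linarith
  have hKinv : (K : ℝ) * (K : ℝ)⁻¹ = 1 := mul_inv_cancel₀ hKpos.ne'
  have hKinv1 : (K : ℝ)⁻¹ < 1 := inv_lt_one_of_one_lt₀ hK1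
  set δ : ℝ := (1 - (K : ℝ)⁻¹) / (1 + C * c)
  have hδ : 0 < δ := div_pos (by linarith) (by positivity)
  have hδeq : δ * (1 + C * c) = 1 - (K : ℝ)⁻¹ := div_mul_cancel₀ _ (by positivity)
  have hδκ0 : 0 ≤ δ * (C * c) := by positivity
  have hδκ : δ * (C * c) ≤ 1 - (K : ℝ)⁻¹ := by linarith
  have hδ1 : δ ≤ 1 - (K : ℝ)⁻¹ := by linarith
  refine ⟨δ, hδ, fun B hB => ?_⟩
  have hnz : ∀ x ∈ B, ∀ y ∈ B, |inner ℝ n (x - y)| ≤ δ * ‖x - y‖ := by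
    intro x hx y hy
    have hxS : ‖x‖ = 1 := by simpa using (hB hx).1
    have hyS : ‖y‖ = 1 := by simpa using (hB hy).1
    have hxn : ‖n - x‖ ≤ δ := by
      rw [← dist_eq_norm, dist_comm]; exact (Metric.mem_ball.1 (hB hx).2).le
    have hyn : ‖n - y‖ ≤ δ := by
      rw [← dist_eq_norm, dist_comm]; exact (Metric.mem_ball.1 (hB hy).2).le
    have horth : inner ℝ (x + y) (x - y) = 0 := by
      rw [real_inner_add_sub_eq_zero_iff, hxS, hyS]
    have h2 : 2 * inner ℝ n (x - y) = inner ℝ ((n - x) + (n - y)) (x - y) := by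
      have : (n - x) + (n - y) = (2 : ℝ) • n - (x + y) := by rw [two_smul]; abel
      rw [this, inner_sub_left, horth, real_inner_smul_left, sub_zero]
    have h3 := (abs_real_inner_le_norm ((n - x) + (n - y)) (x - y)).trans
      (mul_le_mul_of_nonneg_right (norm_add_le _ _) (norm_nonneg _))
    rw [← h2, abs_mul, abs_two] at h3
    nlinarith [norm_nonneg (x - y)]
  have hpsub (x y : V) : i (p x - p y) = (x - y) - inner ℝ n (x - y) • n := by
    rw [map_sub, ← hp, ← hp, inner_sub_right, sub_smul]; abel
  have hpdist (x y : V) : dist (p x) (p y) = ‖(x - y) - inner ℝ n (x - y) • n‖ := by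
    rw [dist_eq_norm, ← i.norm_map, hpsub]
  have hLdist (x y : V) : dist (L x) (L y) = ‖L (x - y)‖ := by rw [dist_eq_norm, map_sub]
  have hLidist (x y : V) : dist (L (i (p x))) (L (i (p y))) =
      ‖L ((x - y) - inner ℝ n (x - y) • n)‖ := by
    rw [dist_eq_norm, ← map_sub, ← map_sub, hpsub]
  have hLerr : ∀ x ∈ B, ∀ y ∈ B,
      ‖L (inner ℝ n (x - y) • n)‖ ≤ δ * (C * c) * ‖L (x - y)‖ := by
    intro x hx y hy
    refine (hC _).trans ?_
    rw [norm_smul, hn, mul_one, Real.norm_eq_abs]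
    calc C * |inner ℝ n (x - y)| ≤ C * (δ * (c * ‖L (x - y)‖)) := by
          gcongr
          exact (hnz x hx y hy).trans (by gcongr; exact hc _)
      _ = _ := by ring
  have hlin : μH[k] ((fun x => L (i (p x))) '' B) =
      ENNReal.ofReal ((L : V →ₗ[ℝ] V) ∘ₗ i.toLinearMap).normDet * μH[k] (p '' B) := by
    have := ((L : V →ₗ[ℝ] V) ∘ₗ i.toLinearMap).hausdorffMeasure_image (p '' B)
    rw [finrank_euclideanSpace_fin, Set.image_image] at this
    exact this
  have h1 : μH[k] (L '' B) ≤ (K : ENNReal) ^ k * μH[k] ((fun x => L (i (p x))) '' B) := by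
    rw [← ENNReal.rpow_natCast]
    refine hausdorffMeasure_image_le_of_dist_le (by positivity) fun x hx y hy => ?_
    rw [hLdist, hLidist]
    have h := hLerr x hx y hy
    have h' := norm_sub_norm_le (L (x - y)) (L (inner ℝ n (x - y) • n))
    rw [← map_sub] at h'
    have h'' : (K : ℝ)⁻¹ * ‖L (x - y)‖ ≤ ‖L ((x - y) - inner ℝ n (x - y) • n)‖ := by
      nlinarith [norm_nonneg (L (x - y))]
    calc ‖L (x - y)‖ = K * ((K : ℝ)⁻¹ * ‖L (x - y)‖) := by rw [← mul_assoc, hKinv, one_mul]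
      _ ≤ _ := by gcongr
  have h2 : μH[k] ((fun x => L (i (p x))) '' B) ≤ (K : ENNReal) ^ k * μH[k] (L '' B) := by
    rw [← ENNReal.rpow_natCast]
    refine hausdorffMeasure_image_le_of_dist_le (by positivity) fun x hx y hy => ?_
    rw [hLidist, hLdist]
    have h := hLerr x hx y hy
    have h' := norm_sub_le (L (x - y)) (L (inner ℝ n (x - y) • n))
    rw [← map_sub] at h'
    have hK2 : 1 + δ * (C * c) ≤ K := by nlinarith [mul_pos hKpos (inv_pos.2 hKpos)]
    nlinarith [norm_nonneg (L (x - y))]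
  have h3 : μH[k] B ≤ (K : ENNReal) ^ k * μH[k] (p '' B) := by
    rw [← ENNReal.rpow_natCast]
    nth_rewrite 1 [← Set.image_id B]
    refine hausdorffMeasure_image_le_of_dist_le (by positivity) fun x hx y hy => ?_
    rw [hpdist, id, id, dist_eq_norm]
    have h := hnz x hx y hy
    have h' := norm_sub_norm_le (x - y) (inner ℝ n (x - y) • n)
    rw [norm_smul, hn, mul_one, Real.norm_eq_abs] at h'
    have h'' : (K : ℝ)⁻¹ * ‖x - y‖ ≤ ‖(x - y) - inner ℝ n (x - y) • n‖ := by
      nlinarith [norm_nonneg (x - y)]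
    calc ‖x - y‖ = K * ((K : ℝ)⁻¹ * ‖x - y‖) := by rw [← mul_assoc, hKinv, one_mul]
      _ ≤ _ := by gcongr
  have h4 : μH[k] (p '' B) ≤ μH[k] B := by
    have : μH[k] (p '' B) ≤ ((1 : NNReal) : ENNReal) ^ (k : ℝ) * μH[k] (id '' B) := by
      refine hausdorffMeasure_image_le_of_dist_le (by positivity) fun x hx y hy => ?_
      rw [hpdist, id, id, dist_eq_norm, NNReal.coe_one, one_mul]
      refine abs_le_of_sq_le_sq' ?_ (norm_nonneg _) |>.2
      rw [norm_sub_sq_real, real_inner_smul_right, norm_smul, hn, real_inner_comm n (x - y)]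
      simp only [Real.norm_eq_abs, mul_one, sq_abs]
      nlinarith [sq_nonneg (inner ℝ n (x - y))]
    simpa using this
  constructor
  · refine h1.trans ?_
    rw [hlin]
    gcongr
  · calc _ ≤ _ * ((K : ENNReal) ^ k * μH[k] (p '' B)) := by gcongr
      _ = (K : ENNReal) ^ k * μH[k] ((fun x => L (i (p x))) '' B) := by rw [hlin]; ring
      _ ≤ _ := by gcongr

theorem LinearEquiv.abs_det_mul_norm_adjoint_symm_pos {V : Type*} [NormedAddCommGroup V]
    [InnerProductSpace ℝ V] [FiniteDimensional ℝ V] (L : V ≃ₗ[ℝ] V) {s : V} (hs : s ≠ 0) :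
    0 < |LinearMap.det (L : V →ₗ[ℝ] V)| * ‖LinearMap.adjoint (L.symm : V →ₗ[ℝ] V) s‖ := by
  refine mul_pos (abs_pos.2 L.isUnit_det'.ne_zero) (norm_pos_iff.2 fun h => hs ?_)
  have := LinearMap.adjoint_inner_left (L.symm : V →ₗ[ℝ] V) (L s) s
  rw [h, inner_zero_left] at this
  simpa using this.symm

open Module in
/-- Area formula for the restriction of a linear equivalence to the unit sphere. -/
theorem LinearEquiv.hausdorffMeasure_image_of_subset_sphere {V : Type*}
    [NormedAddCommGroup V] [InnerProductSpace ℝ V] [FiniteDimensional ℝ V] [MeasurableSpace V]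
    [BorelSpace V] {k : ℕ} (hk : finrank ℝ V = k + 1) (L : V ≃ₗ[ℝ] V) {B : Set V}
    (hBS : B ⊆ Metric.sphere (0 : V) 1) (hB : MeasurableSet B) :
    μH[k] (L '' B) = ∫⁻ s in B, ENNReal.ofReal (|LinearMap.det (L : V →ₗ[ℝ] V)| *
      ‖LinearMap.adjoint (L.symm : V →ₗ[ℝ] V) s‖) ∂μH[k] := by
  set J : V → ℝ := fun s => |LinearMap.det (L : V →ₗ[ℝ] V)| *
      ‖LinearMap.adjoint (L.symm : V →ₗ[ℝ] V) s‖
  have hJc : Continuous J := by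
    have := (LinearMap.adjoint (L.symm : V →ₗ[ℝ] V)).continuous_of_finiteDimensional
    fun_prop
  have hJpos {s : V} (hs : s ∈ Metric.sphere (0 : V) 1) : 0 < J s :=
    L.abs_det_mul_norm_adjoint_symm_pos (ne_zero_of_mem_unit_sphere ⟨s, hs⟩)
  let μ : Measure V := Measure.map L.symm μH[k]
  let ν : Measure V := (μH[k] : Measure V).withDensity fun s => ENNReal.ofReal (J s)
  have hLm : Measurable L.symm := L.symm.toContinuousLinearEquiv.continuous.measurable
  have hμ {B : Set V} (hB : MeasurableSet B) : μ B = μH[k] (L '' B) := by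
    rw [Measure.map_apply hLm hB, L.image_eq_preimage_symm]
  have hν {B : Set V} (hB : MeasurableSet B) :
      ν B = ∫⁻ s in B, ENNReal.ofReal (J s) ∂μH[k] := withDensity_apply _ hB
  have key {K : NNReal} (hK : 1 < K) :
      μ B ≤ (K : ENNReal) ^ (2 * k + 1) * ν B ∧ ν B ≤ (K : ENNReal) ^ (2 * k + 1) * μ B := by
    have hK1 : (1 : ℝ) < K := by exact_mod_cast hK
    have hK1' : (1 : ENNReal) ≤ K := by exact_mod_cast hK.le
    have hloc : ∀ n ∈ Metric.sphere (0 : V) 1, ∃ δ > 0,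
        ∀ B ⊆ Metric.sphere (0 : V) 1 ∩ Metric.ball n δ, MeasurableSet B →
          μ B ≤ (K : ENNReal) ^ (2 * k + 1) * ν B ∧
          ν B ≤ (K : ENNReal) ^ (2 * k + 1) * μ B := by
      intro n hn
      obtain ⟨δ₁, hδ₁, h₁⟩ := L.exists_ball_hausdorffMeasure_image_sphere_le hk
        (by simpa using hn) hK
      have hev : ∀ᶠ s in nhds n, J s < K * J n ∧ J n < K * J s := by
        refine (hJc.continuousAt.eventually_lt continuousAt_const ?_).and
          (continuousAt_const.eventually_lt (hJc.const_mul _).continuousAt ?_) <;>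
        nlinarith [hJpos hn]
      obtain ⟨δ₂, hδ₂, h₂⟩ := Metric.eventually_nhds_iff_ball.1 hev
      refine ⟨min δ₁ δ₂, lt_min hδ₁ hδ₂, fun B hB hBm => ?_⟩
      obtain ⟨ha, hb⟩ := h₁ B (hB.trans
        (Set.inter_subset_inter_right _ (Metric.ball_subset_ball (min_le_left _ _))))
      change _ ≤ _ * (ENNReal.ofReal (J n) * _) at ha
      change ENNReal.ofReal (J n) * _ ≤ _ at hb
      have hB₂ : ∀ s ∈ B, J s < K * J n ∧ J n < K * J s := fun s hs =>
        h₂ s (Metric.ball_subset_ball (min_le_right _ _) (hB hs).2)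
      have hofK (r : ℝ) : ENNReal.ofReal (K * r) = K * ENNReal.ofReal r := by
        rw [ENNReal.ofReal_mul K.coe_nonneg, ENNReal.ofReal_coe_nnreal]
      have hle : ENNReal.ofReal (J n) * μH[k] B ≤ K * ν B := by
        rw [hν hBm, ← lintegral_const_mul _ (by fun_prop), ← setLIntegral_const]
        refine setLIntegral_mono' hBm fun s hs => ?_
        rw [← hofK]
        exact ENNReal.ofReal_le_ofReal (hB₂ s hs).2.le
      have hge : ν B ≤ K * (ENNReal.ofReal (J n) * μH[k] B) := by
        rw [hν hBm, ← mul_assoc, ← hofK, ← setLIntegral_const]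
        exact setLIntegral_mono' hBm fun s hs => ENNReal.ofReal_le_ofReal (hB₂ s hs).1.le
      rw [hμ hBm]
      constructor
      · calc _ ≤ (K : ENNReal) ^ k * (K * ν B) := ha.trans (by gcongr)
          _ = (K : ENNReal) ^ (k + 1) * ν B := by ring
          _ ≤ _ := by gcongr ?_ * _; exact pow_le_pow_right₀ hK1' (by omega)
      · calc _ ≤ K * ((K : ENNReal) ^ k * ((K : ENNReal) ^ k * μH[k] (L '' B))) :=
              hge.trans (by gcongr)
          _ = _ := by ring
    constructor
    · refine Measure.le_mul_of_forall_ball (fun n hn => ?_) hBS hB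
      obtain ⟨δ, hδ, h⟩ := hloc n hn
      exact ⟨δ, hδ, fun B hB hBm => (h B hB hBm).1⟩
    · refine Measure.le_mul_of_forall_ball (fun n hn => ?_) hBS hB
      obtain ⟨δ, hδ, h⟩ := hloc n hn
      exact ⟨δ, hδ, fun B hB hBm => (h B hB hBm).2⟩
  have hlim (a : ENNReal) : Filter.Tendsto (fun K : NNReal => (K : ENNReal) ^ (2 * k + 1) * a)
      (nhdsWithin 1 (Set.Ioi 1)) (nhds a) := by
    have h : Filter.Tendsto (fun K : NNReal => (K : ENNReal) ^ (2 * k + 1)) (nhds 1) (nhds 1) := by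
      have : Continuous (fun K : NNReal => (K : ENNReal) ^ (2 * k + 1)) :=
        (ENNReal.continuous_pow _).comp ENNReal.continuous_coe
      simpa using this.tendsto 1
    simpa using ENNReal.Tendsto.mul_const (b := a) (h.mono_left nhdsWithin_le_nhds)
      (Or.inl one_ne_zero)
  rw [← hμ hB, ← hν hB]
  exact le_antisymm
    (ge_of_tendsto (hlim _) (Filter.eventually_of_mem self_mem_nhdsWithin fun K hK => (key hK).1))
    (ge_of_tendsto (hlim _) (Filter.eventually_of_mem self_mem_nhdsWithin fun K hK => (key hK).2))

open Module in
/-- Integrating the inverse Jacobian over the image of a subset `B` of the unit sphere gives the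
surface measure of `B`. -/
theorem LinearEquiv.setLIntegral_image_inv_jacobian {V : Type*}
    [NormedAddCommGroup V] [InnerProductSpace ℝ V] [FiniteDimensional ℝ V] [MeasurableSpace V]
    [BorelSpace V] {k : ℕ} (hk : finrank ℝ V = k + 1) (L : V ≃ₗ[ℝ] V) {B : Set V}
    (hBS : B ⊆ Metric.sphere (0 : V) 1) (hB : MeasurableSet B) :
    ∫⁻ v in L '' B, ENNReal.ofReal (1 / (|LinearMap.det (L : V →ₗ[ℝ] V)| *
      ‖LinearMap.adjoint (L.symm : V →ₗ[ℝ] V) (L.symm v)‖)) ∂μH[k] = μH[k] B := by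
  set J : V → ℝ := fun s => |LinearMap.det (L : V →ₗ[ℝ] V)| *
      ‖LinearMap.adjoint (L.symm : V →ₗ[ℝ] V) s‖
  have hJm : Measurable J := by
    have := (LinearMap.adjoint (L.symm : V →ₗ[ℝ] V)).continuous_of_finiteDimensional
    fun_prop
  have hLm : Measurable L.symm := L.symm.toContinuousLinearEquiv.continuous.measurable
  have hmap : Measure.map L.symm ((μH[k] : Measure V).restrict (L '' B)) =
      ((μH[k] : Measure V).restrict B).withDensity fun s => ENNReal.ofReal (J s) := by
    ext D hD
    rw [Measure.map_apply hLm hD, Measure.restrict_apply (hLm hD), withDensity_apply _ hD,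
      Measure.restrict_restrict hD, ← L.image_eq_preimage_symm, ← Set.image_inter L.injective,
      L.hausdorffMeasure_image_of_subset_sphere hk (Set.inter_subset_right.trans hBS)
        (hD.inter hB)]
  change ∫⁻ v in L '' B, (fun s => ENNReal.ofReal (1 / J s)) (L.symm v) ∂μH[k] = μH[k] B
  rw [← lintegral_map (f := fun s => ENNReal.ofReal (1 / J s)) (by fun_prop) hLm, hmap,
    lintegral_withDensity_eq_lintegral_mul _ (by fun_prop) (by fun_prop), ← setLIntegral_one]
  refine setLIntegral_congr_fun hB fun s hs => ?_
  have hpos : 0 < J s :=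
    L.abs_det_mul_norm_adjoint_symm_pos (ne_zero_of_mem_unit_sphere ⟨s, hBS hs⟩)
  rw [Pi.mul_apply, ← ENNReal.ofReal_mul hpos.le, mul_one_div_cancel hpos.ne', ENNReal.ofReal_one]

theorem toE_mulVec {d : ℕ} (M : Matrix (Fin d) (Fin d) ℝ) (x : EuclideanSpace ℝ (Fin d)) :
    toE (M.mulVec fun i => x i) = Matrix.toEuclideanLin M x := rfl

/-- Change of measure for the sphere-to-ellipsoid map: for `Lᵀ A L = I`
with `A` symmetric positive definite, the pushforward under `L` of the `(d−1)`-dimensional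
Hausdorff measure on the unit sphere is absolutely continuous with respect to the
`(d−1)`-dimensional Hausdorff measure on the ellipsoid `C = {v : vᵀ A v = 1}`, with density
`v ↦ 1 / J(L⁻¹ v)` where `J(s) = |det L| ‖(Lᵀ)⁻¹ s‖₂`. -/
theorem sphere_to_ellipsoid_change_of_measure
    (d : ℕ) (A L : Matrix (Fin d) (Fin d) ℝ)
    (hA : A.PosDef) (hL : IsUnit L.det) (hLA : Lᵀ * A * L = 1) :
    ∀ E : Set (EuclideanSpace ℝ (Fin d)), MeasurableSet E →
      E ⊆ {v : EuclideanSpace ℝ (Fin d) | (fun i => v i) ⬝ᵥ A.mulVec (fun i => v i) = 1} →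
      ((μH[(d : ℝ) - 1]).restrict
            (Metric.sphere (0 : EuclideanSpace ℝ (Fin d)) 1))
          ((fun s : EuclideanSpace ℝ (Fin d) => toE (L.mulVec fun i => s i)) ⁻¹' E) =
        ∫⁻ v in E,
            ENNReal.ofReal (1 / sphereJacobian L (toE (L⁻¹.mulVec fun i => v i)))
          ∂((μH[(d : ℝ) - 1]).restrict
              {v : EuclideanSpace ℝ (Fin d) |
                (fun i => v i) ⬝ᵥ A.mulVec (fun i => v i) = 1}) := by
  intro E hE hEC
  rcases d with _ | k
  · have : E = ∅ := Set.eq_empty_of_forall_notMem fun v hv => by simpa using hEC hv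
    simp [this]
  simp only [Nat.cast_add, Nat.cast_one, add_sub_cancel_right]
  let ℓ : EuclideanSpace ℝ (Fin (k + 1)) ≃ₗ[ℝ] EuclideanSpace ℝ (Fin (k + 1)) :=
    LinearEquiv.ofLinearMap (Matrix.toEuclideanLin L) (Matrix.toEuclideanLin L⁻¹)
      (by ext1 x; simp [Matrix.toLpLin_apply, Matrix.mul_nonsing_inv _ hL])
      (by ext1 x; simp [Matrix.toLpLin_apply, Matrix.nonsing_inv_mul _ hL])
  have hdet : LinearMap.det (ℓ : EuclideanSpace ℝ (Fin (k + 1)) →ₗ[ℝ] _) = L.det := by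
    change LinearMap.det (Matrix.toEuclideanLin L) = _
    rw [Matrix.toEuclideanLin_eq_toLin_orthonormal, LinearMap.det_toLin]
  have hJ (s : EuclideanSpace ℝ (Fin (k + 1))) : sphereJacobian L s =
      |LinearMap.det (ℓ : EuclideanSpace ℝ (Fin (k + 1)) →ₗ[ℝ] _)| *
      ‖LinearMap.adjoint (ℓ.symm : EuclideanSpace ℝ (Fin (k + 1)) →ₗ[ℝ] _) s‖ := by
    rw [hdet, sphereJacobian, toE_mulVec, ← Matrix.transpose_nonsing_inv,
      ← Matrix.conjTranspose_eq_transpose_of_trivial,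
      Matrix.toEuclideanLin_conjTranspose_eq_adjoint]
    rfl
  have hℓm : Measurable ℓ := ℓ.toContinuousLinearEquiv.continuous.measurable
  have hsphere : ℓ ⁻¹' E ⊆ Metric.sphere (0 : EuclideanSpace ℝ (Fin (k + 1))) 1 := by
    intro s hs
    have h : (L.mulVec fun i => s i) ⬝ᵥ A.mulVec (L.mulVec fun i => s i) = 1 := hEC hs
    rw [Matrix.dotProduct_mulVec, Matrix.vecMul_mulVec, ← Matrix.dotProduct_mulVec,
      Matrix.mulVec_mulVec, hLA, Matrix.one_mulVec] at h
    have h2 : ‖s‖ ^ 2 = 1 := by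
      rw [EuclideanSpace.real_norm_sq_eq, ← h]
      simp [dotProduct, sq]
    simpa using (pow_eq_one_iff_of_nonneg (norm_nonneg s) two_ne_zero).1 h2
  have hEimage : E = ℓ '' (ℓ ⁻¹' E) := (Set.image_preimage_eq _ ℓ.surjective).symm
  rw [Measure.restrict_restrict hE, Set.inter_eq_left.2 hEC]
  change _ = ∫⁻ v in E, ENNReal.ofReal (1 / sphereJacobian L (ℓ.symm v)) ∂μH[k]
  simp only [hJ]
  change (μH[k]).restrict _ (ℓ ⁻¹' E) = _
  rw [Measure.restrict_apply (hℓm hE), Set.inter_eq_left.2 hsphere]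
  conv_rhs => rw [hEimage]
  exact (ℓ.setLIntegral_image_inv_jacobian (by simp) hsphere (hℓm hE)).symm
end
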